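/- arXiv:1508.07223 — 2 statements merged into one kernel-verified Lean document; each statement's English description precedes it below -/
import Mathlib

section
/- Let f, ν : ℝ × ℝ → ℝ^{n+2} and ρ : ℝ × ℝ → ℝ be smooth maps of the variables (s,t) such that ∂²f/∂t²(s,t) = −f(s,t) for all (s,t), ∂f/∂s(s,t) = −ρ(s,t)·∂ν/∂s(s,t) for all (s,t), ∂ν/∂t(s,t) = 0 for all (s,t), and ∂ν/∂s(s,t) ≠ 0 for all (s,t). Then ∂²ρ/∂t²(s,t) = −ρ(s,t) for all (s,t); consequently ρ(s,t) = ρ(s,0)·cos t + (∂ρ/∂t)(s,0)·sin t. -/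
open Real in
/-- A solution of the harmonic oscillator equation is a combination of cosine and sine. -/
theorem eq_cos_smul_add_sin_smul_of_deriv_deriv_eq_neg {E : Type*} [NormedAddCommGroup E]
    [NormedSpace ℝ E] {g : ℝ → E} (hg : Differentiable ℝ g) (hg' : Differentiable ℝ (deriv g))
    (h : ∀ t, deriv (deriv g) t = -g t) (t : ℝ) :
    g t = cos t • g 0 + sin t • deriv g 0 := by
  have hd (x : ℝ) : HasDerivAt g (deriv g x) x := (hg x).hasDerivAt
  have hd' (x : ℝ) : HasDerivAt (deriv g) (-g x) x := h x ▸ (hg' x).hasDerivAt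
  have hA (x : ℝ) : HasDerivAt (fun y => cos y • g y - sin y • deriv g y) 0 x := by
    refine (((hasDerivAt_cos x).fun_smul (hd x)).fun_sub
      ((hasDerivAt_sin x).fun_smul (hd' x))).congr_deriv ?_
    module
  have hB (x : ℝ) : HasDerivAt (fun y => sin y • g y + cos y • deriv g y) 0 x := by
    refine (((hasDerivAt_sin x).fun_smul (hd x)).fun_add
      ((hasDerivAt_cos x).fun_smul (hd' x))).congr_deriv ?_
    module
  have eA := is_const_of_deriv_eq_zero (fun x => (hA x).differentiableAt)
    (fun x => (hA x).deriv) t 0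
  have eB := is_const_of_deriv_eq_zero (fun x => (hB x).differentiableAt)
    (fun x => (hB x).deriv) t 0
  simp only [cos_zero, sin_zero, one_smul, zero_smul, sub_zero, zero_add] at eA eB
  rw [← eA, ← eB]
  calc g t = (sin t ^ 2 + cos t ^ 2) • g t := by rw [sin_sq_add_cos_sq, one_smul]
    _ = _ := by module


/-- Massey-type lemma: along asymptotic (`t`-)curves of a constant curvature 1 front in
`S^{n+1}` (in special coordinates where `f_tt = −f`, `f_s = −ρ ν_s`, `ν_t = 0`, `ν_s ≠ 0`),
the curvature radius function satisfies `ρ_tt = −ρ`, hence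
`ρ(s,t) = ρ(s,0) cos t + ρ_t(s,0) sin t`. -/
theorem stmt8 {n : ℕ}
    (f ν : ℝ → ℝ → EuclideanSpace ℝ (Fin (n + 2))) (ρ : ℝ → ℝ → ℝ)
    (hf : ContDiff ℝ (⊤ : ℕ∞) (fun p : ℝ × ℝ => f p.1 p.2))
    (hν : ContDiff ℝ (⊤ : ℕ∞) (fun p : ℝ × ℝ => ν p.1 p.2))
    (hρ : ContDiff ℝ (⊤ : ℕ∞) (fun p : ℝ × ℝ => ρ p.1 p.2))
    (hftt : ∀ s t, deriv (deriv (f s)) t = -(f s t))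
    (hfs : ∀ s t, deriv (fun s' => f s' t) s = -(ρ s t) • deriv (fun s' => ν s' t) s)
    (hνt : ∀ s t, deriv (ν s) t = 0)
    (hνs : ∀ s t, deriv (fun s' => ν s' t) s ≠ 0) :
    ∀ s t : ℝ, deriv (deriv (ρ s)) t = -(ρ s t) ∧
      ρ s t = ρ s 0 * Real.cos t + deriv (ρ s) 0 * Real.sin t := by
  have hft (s : ℝ) : ContDiff ℝ (⊤ : ℕ∞) (f s) := hf.comp (contDiff_prodMk_right s)
  have hfdiff (s t : ℝ) : DifferentiableAt ℝ (fun s' => f s' t) s :=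
    (hf.comp (contDiff_prodMk_left t)).differentiable (by simp) s
  have hνdiff (s : ℝ) : Differentiable ℝ (ν s) :=
    (hν.comp (contDiff_prodMk_right s)).differentiable (by simp)
  have hν0 (t : ℝ) : (fun s' => ν s' t) = fun s' => ν s' 0 :=
    funext fun s => is_const_of_deriv_eq_zero (hνdiff s) (hνt s) t 0
  have hode (s t : ℝ) : f s t = Real.cos t • f s 0 + Real.sin t • deriv (f s) 0 :=
    eq_cos_smul_add_sin_smul_of_deriv_deriv_eq_neg ((hft s).differentiable (by simp))
      ((contDiff_infty_iff_deriv.1 (hft s)).2.differentiable (by simp)) (hftt s) t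
  -- The initial velocity is the value at `π / 2`, so no mixed partial derivatives are needed.
  have hfexp (s t : ℝ) : f s t = Real.cos t • f s 0 + Real.sin t • f s (Real.pi / 2) := by
    rw [hode s t, hode s (Real.pi / 2)]
    simp
  have hρexp (s t : ℝ) :
      ρ s t = Real.cos t * ρ s 0 + Real.sin t * ρ s (Real.pi / 2) := by
    have hderiv := ((hfdiff s 0).hasDerivAt.fun_const_smul (Real.cos t)).fun_add
      ((hfdiff s (Real.pi / 2)).hasDerivAt.fun_const_smul (Real.sin t))
    have key := hderiv.deriv
    rw [← funext fun s' => hfexp s' t, hfs, hfs, hfs, hν0 t, hν0 (Real.pi / 2)] at key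
    refine smul_left_injective ℝ (hνs s 0) (neg_injective ?_)
    simp only [← neg_smul, key]
    module
  intro s t
  have hd (x : ℝ) : HasDerivAt (ρ s)
      (-Real.sin x * ρ s 0 + Real.cos x * ρ s (Real.pi / 2)) x := by
    rw [funext (hρexp s)]
    simpa using ((Real.hasDerivAt_cos x).mul_const (ρ s 0)).fun_add
      ((Real.hasDerivAt_sin x).mul_const (ρ s (Real.pi / 2)))
  have hd' : HasDerivAt (deriv (ρ s)) (-ρ s t) t := by
    rw [funext fun x => (hd x).deriv]
    refine (((Real.hasDerivAt_sin t).fun_neg.mul_const (ρ s 0)).fun_add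
      ((Real.hasDerivAt_cos t).mul_const (ρ s (Real.pi / 2)))).congr_deriv ?_
    rw [hρexp s t]
    ring
  refine ⟨hd'.deriv, ?_⟩
  rw [hρexp s t, (hd 0).deriv, Real.sin_zero, Real.cos_zero]
  ring
end

section
/- Let γ, e, n, b : ℝ → ℝ⁴ be smooth maps such that for every s the vectors γ(s), e(s), n(s), b(s) are orthonormal in ℝ⁴, and let κ, τ : ℝ → ℝ be smooth functions such that γ′ = e, e′ = −γ + κ n, n′ = −κ e + τ b, and b′ = −τ n. If there exists a linear isometry A : ℝ⁴ → ℝ⁴ such that b(s) = A(γ(s)) for all s ∈ ℝ, then τ(s)² = 1 for all s ∈ ℝ. -/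
/-- If a unit-speed curve `γ` in `S³ ⊂ ℝ⁴` with Frenet frame `{γ, e, n, b}`,
curvature `κ` and torsion `τ` is congruent to its binormal `b` (via a linear isometry
of `ℝ⁴`), then `τ² ≡ 1`. -/
theorem stmt9 (γ e n b : ℝ → EuclideanSpace ℝ (Fin 4)) (κ τ : ℝ → ℝ)
    (hγ : ContDiff ℝ (⊤ : ℕ∞) γ) (he : ContDiff ℝ (⊤ : ℕ∞) e)
    (hn : ContDiff ℝ (⊤ : ℕ∞) n) (hb : ContDiff ℝ (⊤ : ℕ∞) b)
    (hκ : ContDiff ℝ (⊤ : ℕ∞) κ) (hτ : ContDiff ℝ (⊤ : ℕ∞) τ)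
    (horth : ∀ s : ℝ, Orthonormal ℝ ![γ s, e s, n s, b s])
    (hγ' : ∀ s, deriv γ s = e s)
    (he' : ∀ s, deriv e s = -γ s + κ s • n s)
    (hn' : ∀ s, deriv n s = -κ s • e s + τ s • b s)
    (hb' : ∀ s, deriv b s = -τ s • n s)
    (A : EuclideanSpace ℝ (Fin 4) →ₗᵢ[ℝ] EuclideanSpace ℝ (Fin 4))
    (hA : ∀ s, b s = A (γ s)) :
    ∀ s : ℝ, τ s ^ 2 = 1 := by
  intro s
  have hAγ : deriv b s = A (e s) := by
    rw [funext hA, ← hγ' s]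
    exact (A.toContinuousLinearMap.hasFDerivAt.comp_hasDerivAt s
      (hγ.differentiable (by simp) s).hasDerivAt).deriv
  have norm_e : ‖e s‖ = 1 := (horth s).1 1
  have norm_n : ‖n s‖ = 1 := (horth s).1 2
  have abs_τ : |τ s| = 1 := by
    have h := congrArg norm ((hb' s).symm.trans hAγ)
    simpa [norm_smul, norm_e, norm_n] using h
  rw [← sq_abs, abs_τ, one_pow]
end
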